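/- arXiv:1503.01392 — 3 statements merged into one kernel-verified Lean document; each statement's English description precedes it below -/
import Mathlib

section
/- Two valuations ν₁, ν₂ on the tropical semifield ℚ_max are equivalent if and only if ν₁(1) and ν₂(1) have the same sign (both positive, both zero, or both negative), where 1 denotes the rational number 1. Consequently there are exactly three valuations on ℚ_max up to equivalence. -/
/-- `ℚ_max`: the tropical semifield `ℚ ∪ {-∞}`.  Its tropical addition `⊕` is `max`
(with `⊥ = -∞` the least element) and its tropical multiplication `⊙` is the
addition `+` of `WithBot ℚ` (usual addition of rationals, with `⊥` absorbing);
the zero element is `⊥ = -∞` and the multiplicative identity is the rational `0`. -/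
abbrev Qmax := WithBot ℚ

/-- A valuation on `ℚ_max`: a function `ν : ℚ ∪ {-∞} → ℝ ∪ {∞}` such that
(i) `ν x = ∞ ↔ x = -∞`, (ii) `ν (x ⊙ y) = ν x + ν y` (usual addition of reals,
with `r + ∞ = ∞`), and (iii) `min (ν x) (ν y) ≤ ν (x ⊕ y)`. -/
structure QmaxValuation where
  v : Qmax → WithTop ℝ
  eq_top_iff : ∀ x : Qmax, v x = ⊤ ↔ x = ⊥
  map_mul : ∀ x y : Qmax, v (x + y) = v x + v y
  min_le : ∀ x y : Qmax, min (v x) (v y) ≤ v (max x y)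

/-- Two valuations are equivalent if `ν₁ = ρ · ν₂` pointwise for some real `ρ > 0`
(with `ρ · ∞ = ∞`, as holds for the multiplication of `WithTop ℝ` since `ρ ≠ 0`). -/
def QmaxValuation.Equiv (ν₁ ν₂ : QmaxValuation) : Prop :=
  ∃ ρ : ℝ, 0 < ρ ∧ ∀ x : Qmax, ν₁.v x = ((ρ : WithTop ℝ)) * ν₂.v x

/-- Every valuation on `ℚ_max` is linear on the rationals. -/
theorem QmaxValuation.exists_slope (ν : QmaxValuation) :
    ∃ c : ℝ, ∀ q : ℚ, ν.v (q : Qmax) = ((q * c : ℝ) : WithTop ℝ) := by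
  have finite : ∀ q : ℚ, ∃ r : ℝ, (r : WithTop ℝ) = ν.v (q : Qmax) := fun q =>
    WithTop.ne_top_iff_exists.mp fun h => WithBot.coe_ne_bot ((ν.eq_top_iff _).mp h)
  choose f hf using finite
  have f_add : ∀ x y, f (x + y) = f x + f y := by
    intro x y
    have h := ν.map_mul (x : Qmax) (y : Qmax)
    rw [← WithBot.coe_add, ← hf, ← hf, ← hf] at h
    exact_mod_cast h
  refine ⟨f 1, fun q => ?_⟩
  have h := map_rat_smul (AddMonoidHom.mk' f f_add) q (1 : ℚ)
  simp only [AddMonoidHom.mk'_apply, smul_eq_mul, mul_one, Rat.smul_def] at h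
  rw [← hf, h]

/-- The valuation on `ℚ_max` with `q ↦ q * c` on the rationals. -/
noncomputable def QmaxValuation.ofSlope (c : ℝ) : QmaxValuation where
  v := WithBot.recBotCoe ⊤ fun q : ℚ => ((q * c : ℝ) : WithTop ℝ)
  eq_top_iff x := by
    induction x using WithBot.recBotCoe with
    | bot => simp
    | coe q => exact iff_of_false WithTop.coe_ne_top WithBot.coe_ne_bot
  map_mul x y := by
    induction x using WithBot.recBotCoe with
    | bot => simp
    | coe x =>
      induction y using WithBot.recBotCoe with
      | bot => simp
      | coe y =>
        simp only [← WithBot.coe_add, WithBot.recBotCoe_coe, ← WithTop.coe_add, Rat.cast_add,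
          add_mul]
  min_le x y := by
    rcases max_choice x y with h | h <;> rw [h]
    · exact min_le_left _ _
    · exact min_le_right _ _

theorem QmaxValuation.ofSlope_one (c : ℝ) :
    (QmaxValuation.ofSlope c).v ((1 : ℚ) : Qmax) = (c : WithTop ℝ) := by
  change (((1 : ℚ) * c : ℝ) : WithTop ℝ) = c
  rw [Rat.cast_one, one_mul]

theorem QmaxValuation.equiv_iff_exists_slope_eq {ν₁ ν₂ : QmaxValuation} {c₁ c₂ : ℝ}
    (h₁ : ∀ q : ℚ, ν₁.v (q : Qmax) = ((q * c₁ : ℝ) : WithTop ℝ))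
    (h₂ : ∀ q : ℚ, ν₂.v (q : Qmax) = ((q * c₂ : ℝ) : WithTop ℝ)) :
    ν₁.Equiv ν₂ ↔ ∃ ρ : ℝ, 0 < ρ ∧ c₁ = ρ * c₂ := by
  refine exists_congr fun ρ => and_congr_right fun hρ => ⟨fun h => ?_, fun h x => ?_⟩
  · have h' := h ((1 : ℚ) : Qmax)
    rw [h₁, h₂, ← WithTop.coe_mul, WithTop.coe_inj] at h'
    simpa using h'
  · induction x using WithBot.recBotCoe with
    | bot =>
      rw [(ν₁.eq_top_iff _).mpr rfl, (ν₂.eq_top_iff _).mpr rfl, WithTop.mul_top]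
      exact_mod_cast hρ.ne'
    | coe q =>
      rw [h₁, h₂, ← WithTop.coe_mul, h, mul_left_comm]

theorem exists_pos_eq_mul_iff_same_sign (a b : ℝ) :
    (∃ ρ : ℝ, 0 < ρ ∧ a = ρ * b) ↔ (0 < a ∧ 0 < b) ∨ (a = 0 ∧ b = 0) ∨ (a < 0 ∧ b < 0) := by
  constructor
  · rintro ⟨ρ, hρ, rfl⟩
    rcases lt_trichotomy b 0 with h | h | h
    · exact Or.inr (Or.inr ⟨mul_neg_of_pos_of_neg hρ h, h⟩)
    · exact Or.inr (Or.inl ⟨by simp [h], h⟩)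
    · exact Or.inl ⟨mul_pos hρ h, h⟩
  · rintro (⟨ha, hb⟩ | ⟨rfl, rfl⟩ | ⟨ha, hb⟩)
    · exact ⟨a / b, div_pos ha hb, (div_mul_cancel₀ a hb.ne').symm⟩
    · exact ⟨1, one_pos, by simp⟩
    · exact ⟨a / b, div_pos_of_neg_of_neg ha hb, (div_mul_cancel₀ a hb.ne).symm⟩

theorem QmaxValuation.equiv_iff_same_sign (ν₁ ν₂ : QmaxValuation) : ν₁.Equiv ν₂ ↔
    ((0 < ν₁.v ((1 : ℚ) : Qmax) ∧ 0 < ν₂.v ((1 : ℚ) : Qmax)) ∨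
     (ν₁.v ((1 : ℚ) : Qmax) = 0 ∧ ν₂.v ((1 : ℚ) : Qmax) = 0) ∨
     (ν₁.v ((1 : ℚ) : Qmax) < 0 ∧ ν₂.v ((1 : ℚ) : Qmax) < 0)) := by
  obtain ⟨c₁, h₁⟩ := ν₁.exists_slope
  obtain ⟨c₂, h₂⟩ := ν₂.exists_slope
  rw [equiv_iff_exists_slope_eq h₁ h₂, exists_pos_eq_mul_iff_same_sign, h₁, h₂]
  simp only [Rat.cast_one, one_mul]
  norm_cast

/-- Two valuations `ν₁, ν₂` on `ℚ_max` are equivalent iff `ν₁ 1` and `ν₂ 1` have the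
same sign (`1` being the rational number `1`); consequently there are exactly three
valuations on `ℚ_max` up to equivalence. -/
theorem valuations_on_Qmax_up_to_equivalence :
    (∀ ν₁ ν₂ : QmaxValuation, ν₁.Equiv ν₂ ↔
      ((0 < ν₁.v ((1 : ℚ) : Qmax) ∧ 0 < ν₂.v ((1 : ℚ) : Qmax)) ∨
       (ν₁.v ((1 : ℚ) : Qmax) = 0 ∧ ν₂.v ((1 : ℚ) : Qmax) = 0) ∨
       (ν₁.v ((1 : ℚ) : Qmax) < 0 ∧ ν₂.v ((1 : ℚ) : Qmax) < 0))) ∧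
    (∃ a b c : QmaxValuation, ¬ a.Equiv b ∧ ¬ a.Equiv c ∧ ¬ b.Equiv c ∧
      ∀ ν : QmaxValuation, ν.Equiv a ∨ ν.Equiv b ∨ ν.Equiv c) := by
  refine ⟨QmaxValuation.equiv_iff_same_sign, QmaxValuation.ofSlope 1, QmaxValuation.ofSlope 0,
    QmaxValuation.ofSlope (-1), ?_⟩
  simp only [QmaxValuation.equiv_iff_same_sign, QmaxValuation.ofSlope_one]
  refine ⟨by norm_cast, by norm_cast, by norm_cast, fun ν => ?_⟩
  have neg : ((-1 : ℝ) : WithTop ℝ) < 0 := by norm_cast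
  rcases lt_trichotomy (ν.v ((1 : ℚ) : Qmax)) 0 with h | h | h
  · exact Or.inr (Or.inr (Or.inr (Or.inr ⟨h, neg⟩)))
  · exact Or.inr (Or.inl (Or.inr (Or.inl ⟨h, WithTop.coe_zero⟩)))
  · exact Or.inl (Or.inl ⟨h, by norm_cast⟩)
end

section
/- Let ν be a strict valuation on the tropical semifield ℚ_max. Then ν(1) ≥ 0 (where 1 denotes the rational number 1) and ν(q) = q·ν(1) for every q ∈ ℚ. Conversely, for every real c ≥ 0, the map sending q ∈ ℚ to q·c and -∞ to -∞ is a strict valuation on ℚ_max. Hence ν ↦ ν(1) is a bijection between the set of strict valuations on ℚ_max and ℝ_{≥0}; moreover any two strict valuations with ν(1) > 0 are equivalent, so there are exactly two strict valuations on ℚ_max up to equivalence. -/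
/-- A strict valuation on `ℚ_max`: a function `ν : ℚ ∪ {-∞} → ℝ ∪ {-∞}` such that
(i) `ν x = -∞ ↔ x = -∞`, (ii) `ν (x ⊙ y) = ν x + ν y` (usual addition of reals,
with `r + (-∞) = -∞`), and (iii) `ν (x ⊕ y) = max (ν x) (ν y)`. -/
structure QmaxStrictValuation where
  v : Qmax → WithBot ℝ
  eq_bot_iff : ∀ x : Qmax, v x = ⊥ ↔ x = ⊥
  map_mul : ∀ x y : Qmax, v (x + y) = v x + v y
  map_add : ∀ x y : Qmax, v (max x y) = max (v x) (v y)

/-- Two strict valuations are equivalent if `ν₁ = ρ · ν₂` pointwise for some real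
`ρ > 0` (with `ρ · (-∞) = -∞`, as holds in `WithBot ℝ` since `ρ ≠ 0`). -/
def QmaxStrictValuation.Equiv (ν₁ ν₂ : QmaxStrictValuation) : Prop :=
  ∃ ρ : ℝ, 0 < ρ ∧ ∀ x : Qmax, ν₁.v x = ((ρ : WithBot ℝ)) * ν₂.v x

namespace QmaxStrictValuation

@[ext]
theorem ext {ν₁ ν₂ : QmaxStrictValuation} (h : ∀ x, ν₁.v x = ν₂.v x) : ν₁ = ν₂ := by
  cases ν₁
  cases ν₂
  congr
  exact funext h

theorem map_bot (ν : QmaxStrictValuation) : ν.v ⊥ = ⊥ :=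
  (ν.eq_bot_iff ⊥).2 rfl

/-- A strict valuation on `ℚ_max` is multiplication by a nonnegative real on `ℚ`. -/
theorem exists_forall_coe (ν : QmaxStrictValuation) :
    ∃ c : ℝ, 0 ≤ c ∧ ∀ q : ℚ, ν.v (q : Qmax) = ((q * c : ℝ) : WithBot ℝ) := by
  have hcoe (q : ℚ) : ∃ r : ℝ, ν.v (q : Qmax) = (r : WithBot ℝ) := by
    obtain ⟨r, hr⟩ := WithBot.ne_bot_iff_exists.1
      (fun h => WithBot.coe_ne_bot ((ν.eq_bot_iff (q : Qmax)).1 h))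
    exact ⟨r, hr.symm⟩
  choose f hf using hcoe
  have hadd (p q : ℚ) : f (p + q) = f p + f q := by
    have h := ν.map_mul (p : Qmax) (q : Qmax)
    rw [← WithBot.coe_add, hf, hf, hf] at h
    exact_mod_cast h
  have hlin (q : ℚ) : f q = q * f 1 := by
    have h := map_rat_smul (AddMonoidHom.mk' f hadd) q 1
    simpa [Rat.smul_def] using h
  have hmax : f 1 = max (f 1) (f 0) := by
    have h := ν.map_add ((1 : ℚ) : Qmax) ((0 : ℚ) : Qmax)
    rw [← WithBot.coe_max, max_eq_left (zero_le_one' ℚ), hf, hf, ← WithBot.coe_max] at h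
    exact_mod_cast h
  have hzero : f 0 = 0 := by simpa using hlin 0
  refine ⟨f 1, ?_, fun q => by rw [hf, hlin]⟩
  rw [← hzero, hmax]
  exact le_max_right _ _

/-- The strict valuation `q ↦ q * c`, `-∞ ↦ -∞`. -/
noncomputable def ofNonneg (c : ℝ) (hc : 0 ≤ c) : QmaxStrictValuation where
  v := WithBot.map fun q : ℚ => (q * c : ℝ)
  eq_bot_iff _ := WithBot.map_eq_bot_iff
  map_mul x y := by
    cases x using WithBot.recBotCoe with
    | bot => rfl
    | coe p =>
      cases y using WithBot.recBotCoe with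
      | bot => rfl
      | coe q => rw [← WithBot.coe_add, WithBot.map_coe, WithBot.map_coe, WithBot.map_coe,
          Rat.cast_add, add_mul, WithBot.coe_add]
  map_add x y := by
    have hmono : Monotone fun q : ℚ => (q * c : ℝ) := fun p q hpq =>
      mul_le_mul_of_nonneg_right (Rat.cast_le.2 hpq) hc
    exact hmono.withBot_map.map_max

@[simp]
theorem ofNonneg_coe (c : ℝ) (hc : 0 ≤ c) (q : ℚ) :
    (ofNonneg c hc).v (q : Qmax) = ((q * c : ℝ) : WithBot ℝ) :=
  rfl

/-- Valuations with parameters `ρ * c` and `c`, where `ρ > 0`, are equivalent. -/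
theorem equiv_of_eq_mul {ν₁ ν₂ : QmaxStrictValuation} {c₁ c₂ ρ : ℝ} (hρ : 0 < ρ)
    (h₁ : ∀ q : ℚ, ν₁.v (q : Qmax) = ((q * c₁ : ℝ) : WithBot ℝ))
    (h₂ : ∀ q : ℚ, ν₂.v (q : Qmax) = ((q * c₂ : ℝ) : WithBot ℝ)) (h : c₁ = ρ * c₂) :
    ν₁.Equiv ν₂ := by
  refine ⟨ρ, hρ, fun x => ?_⟩
  induction x using WithBot.recBotCoe with
  | bot =>
    rw [map_bot, map_bot, WithBot.mul_bot]
    exact_mod_cast hρ.ne'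
  | coe q =>
    rw [h₁, h₂, ← WithBot.coe_mul, h]
    congr 1
    ring

end QmaxStrictValuation

/-- For any strict valuation `ν` on `ℚ_max`: `ν 1 ≥ 0` and `ν q = q · ν 1` for all
`q ∈ ℚ` (`1` being the rational number `1`); conversely for every real `c ≥ 0` the
map `q ↦ q·c`, `-∞ ↦ -∞` is a strict valuation; `ν ↦ ν 1` is a bijection between
strict valuations on `ℚ_max` and `ℝ≥0`; any two strict valuations with `ν 1 > 0`
are equivalent; and there are exactly two strict valuations up to equivalence. -/
theorem strict_valuations_on_Qmax :
    (∀ ν : QmaxStrictValuation,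
        0 ≤ ν.v ((1 : ℚ) : Qmax) ∧
        ∀ q : ℚ, ν.v (q : Qmax) = ((q : ℝ) : WithBot ℝ) * ν.v ((1 : ℚ) : Qmax)) ∧
    (∀ c : ℝ, 0 ≤ c → ∃ ν : QmaxStrictValuation, ν.v ⊥ = ⊥ ∧
        ∀ q : ℚ, ν.v (q : Qmax) = (((q : ℝ) * c : ℝ) : WithBot ℝ)) ∧
    (∀ ν : QmaxStrictValuation, ∃ c : ℝ, 0 ≤ c ∧ ν.v ((1 : ℚ) : Qmax) = (c : WithBot ℝ)) ∧
    (∀ c : ℝ, 0 ≤ c → ∃! ν : QmaxStrictValuation, ν.v ((1 : ℚ) : Qmax) = (c : WithBot ℝ)) ∧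
    (∀ ν₁ ν₂ : QmaxStrictValuation,
        0 < ν₁.v ((1 : ℚ) : Qmax) → 0 < ν₂.v ((1 : ℚ) : Qmax) → ν₁.Equiv ν₂) ∧
    (∃ a b : QmaxStrictValuation, ¬ a.Equiv b ∧
        ∀ ν : QmaxStrictValuation, ν.Equiv a ∨ ν.Equiv b) := by
  have hone {ν : QmaxStrictValuation} {c : ℝ}
      (h : ∀ q : ℚ, ν.v (q : Qmax) = ((q * c : ℝ) : WithBot ℝ)) :
      ν.v ((1 : ℚ) : Qmax) = (c : WithBot ℝ) := by
    simpa using h 1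
  refine ⟨fun ν => ?_, fun c hc => ?_, fun ν => ?_, fun c hc => ?_, fun ν₁ ν₂ h₁ h₂ => ?_, ?_⟩
  · obtain ⟨c, hc, h⟩ := ν.exists_forall_coe
    rw [hone h]
    exact ⟨by exact_mod_cast hc, fun q => by rw [h, WithBot.coe_mul]⟩
  · exact ⟨.ofNonneg c hc, QmaxStrictValuation.map_bot _, fun _ => rfl⟩
  · obtain ⟨c, hc, h⟩ := ν.exists_forall_coe
    exact ⟨c, hc, hone h⟩
  · refine ⟨.ofNonneg c hc, hone fun _ => rfl, fun ν hν => ?_⟩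
    obtain ⟨d, -, h⟩ := ν.exists_forall_coe
    obtain rfl : d = c :=
      WithBot.coe_injective ((hone h).symm.trans hν)
    ext1 x
    induction x using WithBot.recBotCoe with
    | bot => rw [QmaxStrictValuation.map_bot, QmaxStrictValuation.map_bot]
    | coe q => rw [h, QmaxStrictValuation.ofNonneg_coe]
  · obtain ⟨c₁, -, hν₁⟩ := ν₁.exists_forall_coe
    obtain ⟨c₂, -, hν₂⟩ := ν₂.exists_forall_coe
    rw [hone hν₁] at h₁
    rw [hone hν₂] at h₂
    have hc₁ : 0 < c₁ := by exact_mod_cast h₁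
    have hc₂ : 0 < c₂ := by exact_mod_cast h₂
    exact QmaxStrictValuation.equiv_of_eq_mul (div_pos hc₁ hc₂) hν₁ hν₂
      (div_mul_cancel₀ c₁ hc₂.ne').symm
  · refine ⟨.ofNonneg 0 le_rfl, .ofNonneg 1 zero_le_one, ?_, fun ν => ?_⟩
    · rintro ⟨ρ, hρ, h⟩
      have h1 := h ((1 : ℚ) : Qmax)
      rw [QmaxStrictValuation.ofNonneg_coe, QmaxStrictValuation.ofNonneg_coe,
        ← WithBot.coe_mul, WithBot.coe_inj] at h1
      simp only [Rat.cast_one, mul_zero, mul_one] at h1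
      exact hρ.ne h1
    · obtain ⟨c, hc, h⟩ := ν.exists_forall_coe
      rcases hc.eq_or_lt with rfl | hc
      · exact .inl (QmaxStrictValuation.equiv_of_eq_mul one_pos h
          (QmaxStrictValuation.ofNonneg_coe _ _) (mul_zero 1).symm)
      · exact .inr (QmaxStrictValuation.equiv_of_eq_mul hc h
          (QmaxStrictValuation.ofNonneg_coe _ _) (mul_one c).symm)
end

section
/- Let ν be a valuation of the tropical semifield ℚ_max with values in ℝ_{+,val}. Then ν is order-preserving, ν(1) ≥ 0 (where 1 denotes the rational number 1), and ν(q) = q·ν(1) for every q ∈ ℚ. Conversely, for every real c ≥ 0, the map sending q ∈ ℚ to q·c and -∞ to -∞ is such a valuation. Hence ν ↦ ν(1) is a bijection between the set of valuations of ℚ_max with values in ℝ_{+,val} and ℝ_{≥0}; moreover any two with ν(1) > 0 are equivalent, so there are exactly two such valuations up to equivalence. -/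
/-- A valuation of `ℚ_max` with values in the hyperfield `ℝ_{+,val}`: a function
`ν : ℚ ∪ {-∞} → ℝ ∪ {-∞}` such that (i) `ν x = -∞ ↔ x = -∞`,
(ii) `ν (x ⊙ y) = ν x + ν y` (usual addition of reals, with `r + (-∞) = -∞`), and
(iii) `ν (x ⊕ y) ∈ ν x ⊞ ν y`, i.e. `ν (x ⊕ y) = max (ν x) (ν y)` whenever
`ν x ≠ ν y`, and `ν (x ⊕ y) ≤ ν x` whenever `ν x = ν y`. -/
structure QmaxHyperValuation where
  v : Qmax → WithBot ℝ
  eq_bot_iff : ∀ x : Qmax, v x = ⊥ ↔ x = ⊥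
  map_mul : ∀ x y : Qmax, v (x + y) = v x + v y
  map_add_of_ne : ∀ x y : Qmax, v x ≠ v y → v (max x y) = max (v x) (v y)
  map_add_of_eq : ∀ x y : Qmax, v x = v y → v (max x y) ≤ v x

/-- Two such valuations are equivalent if `ν₁ = ρ · ν₂` pointwise for some real
`ρ > 0` (with `ρ · (-∞) = -∞`, as holds in `WithBot ℝ` since `ρ ≠ 0`). -/
def QmaxHyperValuation.Equiv (ν₁ ν₂ : QmaxHyperValuation) : Prop :=
  ∃ ρ : ℝ, 0 < ρ ∧ ∀ x : Qmax, ν₁.v x = ((ρ : WithBot ℝ)) * ν₂.v x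

namespace QmaxHyperValuation

@[ext]
theorem ext {ν₁ ν₂ : QmaxHyperValuation} (h : ∀ x, ν₁.v x = ν₂.v x) : ν₁ = ν₂ := by
  cases ν₁
  cases ν₂
  congr
  exact funext h

theorem map_bot (ν : QmaxHyperValuation) : ν.v ⊥ = ⊥ :=
  (ν.eq_bot_iff ⊥).2 rfl

/-- A valuation of `ℚ_max` is linear on `ℚ`, with nonnegative slope. -/
theorem exists_slope (ν : QmaxHyperValuation) :
    ∃ c : ℝ, 0 ≤ c ∧ ∀ q : ℚ, ν.v (q : Qmax) = (((q : ℝ) * c : ℝ) : WithBot ℝ) := by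
  have hne (q : ℚ) : ∃ r : ℝ, ν.v (q : Qmax) = (r : WithBot ℝ) := by
    have h : ν.v (q : Qmax) ≠ ⊥ := fun h ↦ WithBot.coe_ne_bot ((ν.eq_bot_iff _).1 h)
    exact ⟨_, (WithBot.coe_unbot _ h).symm⟩
  choose g hg using hne
  have hadd (x y : ℚ) : g (x + y) = g x + g y := by
    have h := ν.map_mul (x : Qmax) (y : Qmax)
    rw [← WithBot.coe_add, hg, hg, hg, ← WithBot.coe_add] at h
    exact WithBot.coe_injective h
  have hlin (q : ℚ) : g q = q * g 1 := by
    have h := map_rat_smul (AddMonoidHom.mk' g hadd) q (1 : ℚ)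
    simpa [Rat.smul_def] using h
  refine ⟨g 1, ?_, fun q ↦ by rw [hg, hlin]⟩
  by_contra! hneg
  have h0 : g 0 = 0 := by simpa using hlin 0
  have hlt : (g 1 : WithBot ℝ) < (g 0 : WithBot ℝ) := by
    rw [h0]
    exact WithBot.coe_lt_coe.2 hneg
  have h := ν.map_add_of_ne ((0 : ℚ) : Qmax) ((1 : ℚ) : Qmax) (by
    rw [hg, hg]
    exact hlt.ne')
  rw [max_eq_right (WithBot.coe_le_coe.2 zero_le_one), hg, hg, max_eq_left hlt.le] at h
  exact hlt.ne h

/-- The valuation of `ℚ_max` given by `q ↦ q * c`. -/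
noncomputable def ofSlope (c : ℝ) (hc : 0 ≤ c) : QmaxHyperValuation :=
  let f : ℚ → ℝ := fun q ↦ q * c
  have hmono : Monotone (WithBot.map f) := WithBot.monotone_map_iff.2 fun _ _ h ↦
    mul_le_mul_of_nonneg_right (Rat.cast_le.2 h) hc
  { v := WithBot.map f
    eq_bot_iff := fun _ ↦ WithBot.map_eq_bot_iff
    map_mul := fun x y ↦ by
      have hadd : ∀ p q : ℚ, f (p + q) = f p + f q := fun p q ↦ by simp [f, add_mul]
      exact WithBot.map_add (AddMonoidHom.mk' f hadd) x y
    map_add_of_ne := fun _ _ _ ↦ hmono.map_max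
    map_add_of_eq := fun _ _ h ↦ by rw [hmono.map_max, ← h, max_self] }

theorem ofSlope_bot (c : ℝ) (hc : 0 ≤ c) : (ofSlope c hc).v ⊥ = ⊥ := rfl

theorem ofSlope_coe (c : ℝ) (hc : 0 ≤ c) (q : ℚ) :
    (ofSlope c hc).v (q : Qmax) = (((q : ℝ) * c : ℝ) : WithBot ℝ) := rfl

theorem eq_ofSlope (ν : QmaxHyperValuation) : ∃ (c : ℝ) (hc : 0 ≤ c), ν = ofSlope c hc := by
  obtain ⟨c, hc, h⟩ := ν.exists_slope
  refine ⟨c, hc, ext fun x ↦ ?_⟩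
  induction x using WithBot.recBotCoe with
  | bot => rw [map_bot, ofSlope_bot]
  | coe q => rw [h, ofSlope_coe]

theorem ofSlope_one (c : ℝ) (hc : 0 ≤ c) :
    (ofSlope c hc).v ((1 : ℚ) : Qmax) = (c : WithBot ℝ) := by
  rw [ofSlope_coe, Rat.cast_one, one_mul]

theorem ofSlope_monotone (c : ℝ) (hc : 0 ≤ c) : Monotone (ofSlope c hc).v :=
  WithBot.monotone_map_iff.2 fun _ _ h ↦ mul_le_mul_of_nonneg_right (Rat.cast_le.2 h) hc

theorem ofSlope_equiv {c d ρ : ℝ} (hc : 0 ≤ c) (hd : 0 ≤ d) (hρ : 0 < ρ) (h : c = ρ * d) :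
    (ofSlope c hc).Equiv (ofSlope d hd) := by
  refine ⟨ρ, hρ, fun x ↦ ?_⟩
  induction x using WithBot.recBotCoe with
  | bot =>
    rw [ofSlope_bot, ofSlope_bot, WithBot.mul_bot]
    exact (WithBot.coe_pos.2 hρ).ne'
  | coe q =>
    rw [ofSlope_coe, ofSlope_coe, ← WithBot.coe_mul, h, mul_left_comm]

theorem ofSlope_equiv_of_pos {c d : ℝ} (hc : 0 < c) (hd : 0 < d) :
    (ofSlope c hc.le).Equiv (ofSlope d hd.le) :=
  ofSlope_equiv _ _ (div_pos hc hd) (div_mul_cancel₀ c hd.ne').symm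

end QmaxHyperValuation

/-- For any valuation `ν` of `ℚ_max` with values in `ℝ_{+,val}`: `ν` is
order-preserving, `ν 1 ≥ 0`, and `ν q = q · ν 1` for all `q ∈ ℚ` (`1` being the
rational number `1`); conversely for every real `c ≥ 0` the map `q ↦ q·c`,
`-∞ ↦ -∞` is such a valuation; `ν ↦ ν 1` is a bijection between these valuations
and `ℝ≥0`; any two with `ν 1 > 0` are equivalent; and there are exactly two such
valuations up to equivalence. -/
theorem hyperfield_valuations_on_Qmax :
    (∀ ν : QmaxHyperValuation,
        (∀ x y : Qmax, x ≤ y → ν.v x ≤ ν.v y) ∧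
        0 ≤ ν.v ((1 : ℚ) : Qmax) ∧
        ∀ q : ℚ, ν.v (q : Qmax) = ((q : ℝ) : WithBot ℝ) * ν.v ((1 : ℚ) : Qmax)) ∧
    (∀ c : ℝ, 0 ≤ c → ∃ ν : QmaxHyperValuation, ν.v ⊥ = ⊥ ∧
        ∀ q : ℚ, ν.v (q : Qmax) = (((q : ℝ) * c : ℝ) : WithBot ℝ)) ∧
    (∀ ν : QmaxHyperValuation, ∃ c : ℝ, 0 ≤ c ∧ ν.v ((1 : ℚ) : Qmax) = (c : WithBot ℝ)) ∧
    (∀ c : ℝ, 0 ≤ c → ∃! ν : QmaxHyperValuation, ν.v ((1 : ℚ) : Qmax) = (c : WithBot ℝ)) ∧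
    (∀ ν₁ ν₂ : QmaxHyperValuation,
        0 < ν₁.v ((1 : ℚ) : Qmax) → 0 < ν₂.v ((1 : ℚ) : Qmax) → ν₁.Equiv ν₂) ∧
    (∃ a b : QmaxHyperValuation, ¬ a.Equiv b ∧
        ∀ ν : QmaxHyperValuation, ν.Equiv a ∨ ν.Equiv b) := by
  refine ⟨fun ν ↦ ?_, fun c hc ↦ ⟨.ofSlope c hc, rfl, fun _ ↦ rfl⟩, fun ν ↦ ?_,
    fun c hc ↦ ⟨.ofSlope c hc, QmaxHyperValuation.ofSlope_one c hc, fun ν h ↦ ?_⟩,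
    fun ν₁ ν₂ h₁ h₂ ↦ ?_,
    .ofSlope 0 le_rfl, .ofSlope 1 zero_le_one, fun ⟨ρ, hρ, h⟩ ↦ ?_, fun ν ↦ ?_⟩
  · obtain ⟨c, hc, rfl⟩ := ν.eq_ofSlope
    refine ⟨fun x y h ↦ QmaxHyperValuation.ofSlope_monotone c hc h, ?_, fun q ↦ ?_⟩
    · rw [QmaxHyperValuation.ofSlope_one]
      exact WithBot.coe_nonneg.2 hc
    · rw [QmaxHyperValuation.ofSlope_one, QmaxHyperValuation.ofSlope_coe, WithBot.coe_mul]
  · obtain ⟨c, hc, rfl⟩ := ν.eq_ofSlope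
    exact ⟨c, hc, QmaxHyperValuation.ofSlope_one c hc⟩
  · obtain ⟨d, hd, rfl⟩ := ν.eq_ofSlope
    rw [QmaxHyperValuation.ofSlope_one] at h
    obtain rfl := WithBot.coe_injective h
    rfl
  · obtain ⟨c, hc, rfl⟩ := ν₁.eq_ofSlope
    obtain ⟨d, hd, rfl⟩ := ν₂.eq_ofSlope
    rw [QmaxHyperValuation.ofSlope_one] at h₁ h₂
    exact QmaxHyperValuation.ofSlope_equiv_of_pos (WithBot.coe_pos.1 h₁) (WithBot.coe_pos.1 h₂)
  · have h1 := h ((1 : ℚ) : Qmax)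
    rw [QmaxHyperValuation.ofSlope_one, QmaxHyperValuation.ofSlope_one, ← WithBot.coe_mul,
      mul_one] at h1
    exact hρ.ne (WithBot.coe_injective h1)
  · obtain ⟨c, hc, rfl⟩ := ν.eq_ofSlope
    rcases hc.eq_or_lt with rfl | hpos
    · exact .inl (QmaxHyperValuation.ofSlope_equiv _ _ one_pos (mul_zero 1).symm)
    · exact .inr (QmaxHyperValuation.ofSlope_equiv_of_pos hpos one_pos)
end
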